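/- arXiv:1907.12416 — 2 statements merged into one kernel-verified Lean document; each statement's English description precedes it below -/
import Mathlib

section
/- Let μ₊ and μ₋ be probability measures on a measurable space X, let π ∈ [0,1], let μ = π·μ₊ + (1−π)·μ₋, and let f : X → ℝ be measurable. Then the PU AUC risk equals a linear transformation of the PN AUC risk: R_PU(f) = π/2 + (1−π)·R_PN(f), where R_PU(f) = ∫∫ l01(f(x), f(x')) dμ(x') dμ₊(x) and R_PN(f) = ∫∫ l01(f(x), f(x')) dμ₋(x') dμ₊(x). -/
open MeasureTheory

/-- The zero-one pairwise loss `l01(u,v) = (1 - sign(u - v))/2`, with `sign 0 = 0`. -/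
noncomputable def l01 (u v : ℝ) : ℝ := (1 - Real.sign (u - v)) / 2

theorem measurable_real_sign : Measurable Real.sign :=
  Measurable.ite measurableSet_Iio measurable_const
    (Measurable.ite measurableSet_Ioi measurable_const measurable_const)

theorem measurable_l01 : Measurable (fun p : ℝ × ℝ => l01 p.1 p.2) :=
  ((measurable_real_sign.comp (measurable_fst.sub measurable_snd)).const_sub 1).div_const 2

theorem l01_swap (u v : ℝ) : l01 v u = 1 - l01 u v := by
  have h : Real.sign (v - u) = -Real.sign (u - v) := by rw [← Real.sign_neg, neg_sub]
  unfold l01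
  rw [h]
  ring

theorem norm_l01_le_one (u v : ℝ) : ‖l01 u v‖ ≤ 1 := by
  unfold l01
  rcases Real.sign_apply_eq (u - v) with h | h | h <;> rw [h] <;> norm_num

theorem integrable_l01_prod {X Y : Type*} [MeasurableSpace X] [MeasurableSpace Y]
    (μ : Measure X) (ν : Measure Y) [IsFiniteMeasure μ] [IsFiniteMeasure ν]
    {f : X → ℝ} {g : Y → ℝ} (hf : Measurable f) (hg : Measurable g) :
    Integrable (fun p : X × Y => l01 (f p.1) (g p.2)) (μ.prod ν) :=
  Integrable.of_bound (measurable_l01.comp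
    ((hf.comp measurable_fst).prodMk (hg.comp measurable_snd))).aestronglyMeasurable 1
    (.of_forall fun _ => norm_l01_le_one _ _)

theorem integrable_l01_right {X : Type*} [MeasurableSpace X] (μ : Measure X) [IsFiniteMeasure μ]
    {f : X → ℝ} (hf : Measurable f) (u : ℝ) : Integrable (fun x => l01 u (f x)) μ :=
  Integrable.of_bound (measurable_l01.comp (measurable_const.prodMk hf)).aestronglyMeasurable 1
    (.of_forall fun _ => norm_l01_le_one _ _)

/-- The pairwise zero-one risk of a distribution against itself is `1 / 2`. -/
theorem integral_integral_l01_self {X : Type*} [MeasurableSpace X] (μ : Measure X)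
    [IsProbabilityMeasure μ] {f : X → ℝ} (hf : Measurable f) :
    ∫ x, ∫ x', l01 (f x) (f x') ∂μ ∂μ = 1 / 2 := by
  have hint := integrable_l01_prod μ μ hf hf
  have hswap : ∫ p, l01 (f p.1) (f p.2) ∂μ.prod μ = ∫ p, (1 - l01 (f p.1) (f p.2)) ∂μ.prod μ := by
    rw [← integral_prod_swap]
    exact integral_congr_ae (.of_forall fun p => l01_swap _ _)
  rw [integral_sub (integrable_const 1) hint, integral_const, probReal_univ, one_smul,
    integral_prod _ hint] at hswap
  linarith

/-- The PU AUC risk is a linear transformation of the PN AUC risk: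
`R_PU(f) = π/2 + (1 - π) · R_PN(f)`, where the unlabeled marginal is
`μ = π·μ₊ + (1 - π)·μ₋`. -/
theorem R_PU_eq_linear_transform_R_PN {X : Type*} [MeasurableSpace X]
    (μp μn μ : Measure X) [IsProbabilityMeasure μp] [IsProbabilityMeasure μn]
    (π : ℝ) (hπ0 : 0 ≤ π) (hπ1 : π ≤ 1)
    (hμ : μ = ENNReal.ofReal π • μp + ENNReal.ofReal (1 - π) • μn)
    (f : X → ℝ) (hf : Measurable f) :
    ∫ x, ∫ x', l01 (f x) (f x') ∂μ ∂μp
      = π / 2 + (1 - π) * ∫ x, ∫ x', l01 (f x) (f x') ∂μn ∂μp := by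
  have inner (x : X) : ∫ x', l01 (f x) (f x') ∂μ =
      π * ∫ x', l01 (f x) (f x') ∂μp + (1 - π) * ∫ x', l01 (f x) (f x') ∂μn := by
    rw [hμ, integral_add_measure
      ((integrable_l01_right μp hf _).smul_measure ENNReal.ofReal_ne_top)
      ((integrable_l01_right μn hf _).smul_measure ENNReal.ofReal_ne_top),
      integral_smul_measure, integral_smul_measure, ENNReal.toReal_ofReal hπ0,
      ENNReal.toReal_ofReal (sub_nonneg.2 hπ1), smul_eq_mul, smul_eq_mul]
  simp_rw [inner]
  rw [integral_add ((integrable_l01_prod μp μp hf hf).integral_prod_left.const_mul π)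
    ((integrable_l01_prod μp μn hf hf).integral_prod_left.const_mul (1 - π)),
    integral_const_mul, integral_const_mul, integral_integral_l01_self μp hf]
  ring
end

section
/- Let η > 1 and β₁, β₂ ≥ 0, and let (e_t)_{t≥1} be a sequence of nonnegative real numbers satisfying e_{t+1} ≤ (1 − η/t)·e_t + (β₁/t^{3/2})·√(e_t) + β₂/t² for all t ≥ 1. Define R₀ = (β₁ + √(β₁² + 4(η−1)β₂)) / (2(η−1)) and R² = max{ max_{1 ≤ s ≤ ⌈η⌉} s·e_s , R₀² }. Then e_t ≤ R²/t for all t ≥ 1. In particular, the error sequence converges to 0 at rate O(1/t); applied with η = 2θλ, β₁ = 2√2·κ^{1/2}·L·M·(κ+φ)·θ², and β₂ = κM²θ²(1+λθ)², this yields the O(1/t) convergence of E[‖h_{t+1} − f*‖²_H] in the error-due-to-random-data analysis. -/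
open Finset

/-- Every number above the larger root of `a x² - b x - c` makes this quadratic nonnegative. -/
theorem quadratic_nonneg_of_larger_root_le {a b c x : ℝ} (ha : 0 < a) (hc : 0 ≤ c)
    (hx : (b + √(b ^ 2 + 4 * a * c)) / (2 * a) ≤ x) : b * x + c ≤ a * x ^ 2 := by
  rw [div_le_iff₀ (by positivity)] at hx
  have hD : 0 ≤ b ^ 2 + 4 * a * c := by positivity
  have hsq : b ^ 2 + 4 * a * c ≤ (2 * a * x - b) ^ 2 := by
    rw [← Real.sq_sqrt hD]
    exact pow_le_pow_left₀ (Real.sqrt_nonneg _) (by linarith) 2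
  nlinarith

/-- One step of the recursion preserves the bound `e_t ≤ R² / t` once `η ≤ t`. -/
theorem recursion_step_le_div {η β₁ β₂ R x t : ℝ} (hβ₁ : 0 ≤ β₁) (hR : 0 ≤ R) (ht : 0 < t)
    (hηt : η ≤ t) (hquad : β₁ * R + β₂ ≤ (η - 1) * R ^ 2) (hx : x ≤ R ^ 2 / t) :
    (1 - η / t) * x + β₁ / t ^ ((3 : ℝ) / 2) * √x + β₂ / t ^ 2 ≤ R ^ 2 / (t + 1) := by
  have hpow : t ^ ((3 : ℝ) / 2) = t * √t := by
    rw [Real.sqrt_eq_rpow, show (3 : ℝ) / 2 = 1 + 1 / 2 by norm_num, Real.rpow_add ht,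
      Real.rpow_one]
  have hsqrt : √x ≤ R / √t := by
    simpa [Real.sqrt_div (sq_nonneg R), Real.sqrt_sq hR] using Real.sqrt_le_sqrt hx
  have hlin : (1 - η / t) * x ≤ (1 - η / t) * (R ^ 2 / t) :=
    mul_le_mul_of_nonneg_left hx (sub_nonneg.mpr ((div_le_one ht).mpr hηt))
  have hnoise : β₁ / t ^ ((3 : ℝ) / 2) * √x ≤ β₁ * R / t ^ 2 := by
    calc β₁ / t ^ ((3 : ℝ) / 2) * √x ≤ β₁ / (t * √t) * (R / √t) := by
          rw [hpow]
          gcongr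
      _ = β₁ * R / t ^ 2 := by
          rw [div_mul_div_comm, mul_assoc, Real.mul_self_sqrt ht.le, sq]
  calc (1 - η / t) * x + β₁ / t ^ ((3 : ℝ) / 2) * √x + β₂ / t ^ 2
      ≤ (1 - η / t) * (R ^ 2 / t) + β₁ * R / t ^ 2 + β₂ / t ^ 2 := by gcongr
    _ = ((t - η) * R ^ 2 + (β₁ * R + β₂)) / t ^ 2 := by
        field_simp
        ring
    _ ≤ (t - 1) * R ^ 2 / t ^ 2 := by
        gcongr
        linarith
    _ ≤ R ^ 2 / (t + 1) := by
        rw [div_le_div_iff₀ (by positivity) (by positivity)]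
        nlinarith [sq_nonneg R]

/-- Recursion lemma for the error-due-to-random-data analysis: if a nonnegative sequence
satisfies `e_{t+1} ≤ (1 - η/t)·e_t + (β₁/t^{3/2})·√(e_t) + β₂/t²` with `η > 1`, then
`e_t ≤ R²/t` for all `t ≥ 1`, where
`R₀ = (β₁ + √(β₁² + 4(η-1)β₂)) / (2(η-1))` and
`R² = max { max_{1 ≤ s ≤ ⌈η⌉} s·e_s , R₀² }`; in particular `e_t = O(1/t)`. -/
theorem recursion_lemma_O_one_over_t (η β₁ β₂ : ℝ) (hη : 1 < η)
    (hβ₁ : 0 ≤ β₁) (hβ₂ : 0 ≤ β₂)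
    (e : ℕ → ℝ) (he : ∀ t : ℕ, 0 ≤ e t)
    (hrec : ∀ t : ℕ, 1 ≤ t →
      e (t + 1) ≤ (1 - η / t) * e t
        + β₁ / (t : ℝ) ^ ((3 : ℝ) / 2) * Real.sqrt (e t) + β₂ / (t : ℝ) ^ 2) :
    ∀ t : ℕ, 1 ≤ t →
      e t ≤ (max
          ((Finset.Icc 1 ⌈η⌉₊).sup'
            (Finset.nonempty_Icc.mpr (Nat.one_le_ceil_iff.mpr (by linarith)))
            (fun s => (s : ℝ) * e s))
          (((β₁ + Real.sqrt (β₁ ^ 2 + 4 * (η - 1) * β₂)) / (2 * (η - 1))) ^ 2)) / t := by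
  have hceil : 1 ≤ ⌈η⌉₊ := Nat.one_le_ceil_iff.mpr (by linarith)
  have hη' : 0 < η - 1 := sub_pos.mpr hη
  set M := (Finset.Icc 1 ⌈η⌉₊).sup' (Finset.nonempty_Icc.mpr hceil) (fun s => (s : ℝ) * e s)
  set R₀ := (β₁ + √(β₁ ^ 2 + 4 * (η - 1) * β₂)) / (2 * (η - 1))
  have hS : 0 ≤ max M (R₀ ^ 2) := le_max_of_le_right (sq_nonneg R₀)
  have hquad : β₁ * √(max M (R₀ ^ 2)) + β₂ ≤ (η - 1) * √(max M (R₀ ^ 2)) ^ 2 :=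
    quadratic_nonneg_of_larger_root_le hη' hβ₂ (Real.le_sqrt_of_sq_le (le_max_right _ _))
  have hinit : ∀ t : ℕ, 1 ≤ t → t ≤ ⌈η⌉₊ → e t ≤ max M (R₀ ^ 2) / t := by
    intro t ht htη
    rw [le_div_iff₀ (by exact_mod_cast ht), mul_comm]
    exact le_max_of_le_left
      (Finset.le_sup' (fun s : ℕ => (s : ℝ) * e s) (Finset.mem_Icc.mpr ⟨ht, htη⟩))
  intro t ht
  rcases le_total t ⌈η⌉₊ with htη | htη
  · exact hinit t ht htη
  · clear ht
    induction t, htη using Nat.le_induction with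
    | base => exact hinit _ hceil le_rfl
    | succ t htη ih =>
      have ht : 1 ≤ t := hceil.trans htη
      have hstep := recursion_step_le_div (x := e t) hβ₁ (Real.sqrt_nonneg _)
        (Nat.cast_pos.mpr ht) (Nat.ceil_le.mp htη) hquad (by rwa [Real.sq_sqrt hS])
      rw [Real.sq_sqrt hS] at hstep
      exact_mod_cast (hrec t ht).trans hstep
end
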